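/- Let u be three times continuously differentiable on an open set U ⊆ ℂ⁴ and suppose u satisfies the general heavenly equation Φ = 0 on U. Then for every λ ∈ ℂ and every twice continuously differentiable f : U → ℂ, u_{34}·[X₁,X₂]f = {u_{34}u_{234} − u_{23}u_{344} + λβ(u_{24}u_{334} − u_{34}u_{234})}·X₁f + {u_{34}u_{134} − u_{13}u_{344} + λγ(u_{34}u_{134} − u_{14}u_{334})}·X₂f on U, where [X₁,X₂]f = X₁(X₂f) − X₂(X₁f). -/

import Mathlib

/-!  Coordinates: `z : Fin 4 → ℂ` with paper indices `z¹,z²,z³,z⁴` corresponding to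
`z 0, z 1, z 2, z 3`.  `pd i f` is the partial derivative ∂f/∂zⁱ. -/

/-- Partial derivative of `f : ℂ⁴ → ℂ` in the `i`-th coordinate direction. -/
noncomputable def pd (i : Fin 4) (f : (Fin 4 → ℂ) → ℂ) : (Fin 4 → ℂ) → ℂ :=
  fun z => fderiv ℂ f z (Pi.single i 1)

/-- The left-hand side Φ = α u₁₂u₃₄ + β u₁₃u₂₄ + γ u₁₄u₂₃ of the general heavenly
equation (paper indices 1,2,3,4 ↦ 0,1,2,3). -/
noncomputable def Phi (α β γ : ℂ) (u : (Fin 4 → ℂ) → ℂ) : (Fin 4 → ℂ) → ℂ :=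
  fun z => α * pd 0 (pd 1 u) z * pd 2 (pd 3 u) z
    + β * pd 0 (pd 2 u) z * pd 1 (pd 3 u) z
    + γ * pd 0 (pd 3 u) z * pd 1 (pd 2 u) z

/-- The Lax operator `X₁ f = u₃₄ f₁ − u₁₃ f₄ + γλ(u₃₄ f₁ − u₁₄ f₃)`. -/
noncomputable def X1 (γ lam : ℂ) (u f : (Fin 4 → ℂ) → ℂ) : (Fin 4 → ℂ) → ℂ :=
  fun z => pd 2 (pd 3 u) z * pd 0 f z - pd 0 (pd 2 u) z * pd 3 f z
    + γ * lam * (pd 2 (pd 3 u) z * pd 0 f z - pd 0 (pd 3 u) z * pd 2 f z)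

/-- The Lax operator `X₂ f = u₂₃ f₄ − u₃₄ f₂ + βλ(u₃₄ f₂ − u₂₄ f₃)`. -/
noncomputable def X2 (β lam : ℂ) (u f : (Fin 4 → ℂ) → ℂ) : (Fin 4 → ℂ) → ℂ :=
  fun z => pd 1 (pd 2 u) z * pd 3 f z - pd 2 (pd 3 u) z * pd 1 f z
    + β * lam * (pd 2 (pd 3 u) z * pd 1 f z - pd 1 (pd 3 u) z * pd 2 f z)

/-- `L₀ = (1/u₃₄) X₁`. -/
noncomputable def L0 (γ lam : ℂ) (u f : (Fin 4 → ℂ) → ℂ) : (Fin 4 → ℂ) → ℂ :=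
  fun z => X1 γ lam u f z / pd 2 (pd 3 u) z

/-- `M₀ = (1/u₃₄) X₂`. -/
noncomputable def M0 (β lam : ℂ) (u f : (Fin 4 → ℂ) → ℂ) : (Fin 4 → ℂ) → ℂ :=
  fun z => X2 β lam u f z / pd 2 (pd 3 u) z

theorem pd_contDiffOn {U : Set (Fin 4 → ℂ)} (hU : IsOpen U) {n m : WithTop ℕ∞}
    {g : (Fin 4 → ℂ) → ℂ} (hg : ContDiffOn ℂ n g U) (h : m + 1 ≤ n) (i : Fin 4) :
    ContDiffOn ℂ m (pd i g) U := by
  have := hg.fderiv_of_isOpen hU h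
  exact this.clm_apply contDiffOn_const

theorem pd_symm {U : Set (Fin 4 → ℂ)} (hU : IsOpen U)
    {g : (Fin 4 → ℂ) → ℂ} (hg : ContDiffOn ℂ 2 g U) (i j : Fin 4) :
    ∀ z ∈ U, pd i (pd j g) z = pd j (pd i g) z := by
  intro z hz
  have hgz := hg.contDiffAt (hU.mem_nhds hz)
  have hs : IsSymmSndFDerivAt ℂ g z := hgz.isSymmSndFDerivAt (by simp)
  have hd : DifferentiableAt ℂ (fderiv ℂ g) z :=
    (hgz.fderiv_right (m := 1) (by norm_num)).differentiableAt (by norm_num)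
  have key : ∀ a b : Fin 4, pd a (pd b g) z
      = fderiv ℂ (fderiv ℂ g) z (Pi.single a 1) (Pi.single b 1) := by
    intro a b
    have h := (hd.hasFDerivAt.clm_apply (hasFDerivAt_const (Pi.single b (1:ℂ)) z)).fderiv
    unfold pd
    rw [h]
    simp
  rw [key, key]
  exact hs _ _

theorem pd_congr {U : Set (Fin 4 → ℂ)} (hU : IsOpen U)
    {g h : (Fin 4 → ℂ) → ℂ} (hg : ∀ z ∈ U, g z = h z) (i : Fin 4) :
    ∀ z ∈ U, pd i g z = pd i h z := by
  intro z hz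
  have : g =ᶠ[nhds z] h := Filter.eventually_of_mem (hU.mem_nhds hz) hg
  unfold pd
  rw [this.fderiv_eq]

theorem pd_add {g h : (Fin 4 → ℂ) → ℂ} {z} (hg : DifferentiableAt ℂ g z)
    (hh : DifferentiableAt ℂ h z) (i : Fin 4) :
    pd i (fun w => g w + h w) z = pd i g z + pd i h z := by
  unfold pd
  rw [(hg.hasFDerivAt.fun_add hh.hasFDerivAt).fderiv]; simp

theorem pd_sub {g h : (Fin 4 → ℂ) → ℂ} {z} (hg : DifferentiableAt ℂ g z)
    (hh : DifferentiableAt ℂ h z) (i : Fin 4) :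
    pd i (fun w => g w - h w) z = pd i g z - pd i h z := by
  unfold pd
  rw [(hg.hasFDerivAt.fun_sub hh.hasFDerivAt).fderiv]; simp

theorem pd_mul {g h : (Fin 4 → ℂ) → ℂ} {z} (hg : DifferentiableAt ℂ g z)
    (hh : DifferentiableAt ℂ h z) (i : Fin 4) :
    pd i (fun w => g w * h w) z = g z * pd i h z + h z * pd i g z := by
  unfold pd
  rw [(hg.hasFDerivAt.fun_mul hh.hasFDerivAt).fderiv]; simp

theorem pd_cmul {h : (Fin 4 → ℂ) → ℂ} {z} (c : ℂ)
    (hh : DifferentiableAt ℂ h z) (i : Fin 4) :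
    pd i (fun w => c * h w) z = c * pd i h z := by
  unfold pd
  rw [(hh.hasFDerivAt.const_mul c).fderiv]; simp

/-- on solutions of the general heavenly equation,
`u₃₄·[X₁,X₂]f = {u₃₄u₂₃₄ − u₂₃u₃₄₄ + λβ(u₂₄u₃₃₄ − u₃₄u₂₃₄)}·X₁f
             + {u₃₄u₁₃₄ − u₁₃u₃₄₄ + λγ(u₃₄u₁₃₄ − u₁₄u₃₃₄)}·X₂f`. -/
theorem X_commutator_on_solutions
    (U : Set (Fin 4 → ℂ)) (hU : IsOpen U)
    (u : (Fin 4 → ℂ) → ℂ) (hu : ContDiffOn ℂ 3 u U)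
    (α β γ lam : ℂ) (hαβγ : α + β + γ = 0)
    (heav : ∀ z ∈ U, Phi α β γ u z = 0)
    (f : (Fin 4 → ℂ) → ℂ) (hf : ContDiffOn ℂ 2 f U) :
    ∀ z ∈ U,
      pd 2 (pd 3 u) z * (X1 γ lam u (X2 β lam u f) z - X2 β lam u (X1 γ lam u f) z)
        = (pd 2 (pd 3 u) z * pd 1 (pd 2 (pd 3 u)) z
            - pd 1 (pd 2 u) z * pd 2 (pd 3 (pd 3 u)) z
            + lam * β * (pd 1 (pd 3 u) z * pd 2 (pd 2 (pd 3 u)) z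
                - pd 2 (pd 3 u) z * pd 1 (pd 2 (pd 3 u)) z)) * X1 γ lam u f z
        + (pd 2 (pd 3 u) z * pd 0 (pd 2 (pd 3 u)) z
            - pd 0 (pd 2 u) z * pd 2 (pd 3 (pd 3 u)) z
            + lam * γ * (pd 2 (pd 3 u) z * pd 0 (pd 2 (pd 3 u)) z
                - pd 0 (pd 3 u) z * pd 2 (pd 2 (pd 3 u)) z)) * X2 β lam u f z := by
  intro z hz
  have hnz := hU.mem_nhds hz
  have hu1 : ∀ i, ContDiffOn ℂ 2 (pd i u) U := fun i => pd_contDiffOn hU hu (by norm_num) i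
  have du : ∀ i j, DifferentiableAt ℂ (pd i (pd j u)) z := fun i j =>
    ((pd_contDiffOn (m := 1) hU (hu1 j) (by norm_num) i).contDiffAt hnz).differentiableAt
      (by norm_num)
  have df : ∀ i, DifferentiableAt ℂ (pd i f) z := fun i =>
    ((pd_contDiffOn (m := 1) hU hf (by norm_num) i).contDiffAt hnz).differentiableAt
      (by norm_num)
  have sf : ∀ i j, pd i (pd j f) z = pd j (pd i f) z := fun i j => pd_symm hU hf i j z hz
  have s3 : ∀ i j k, pd i (pd j (pd k u)) z = pd j (pd i (pd k u)) z := fun i j k =>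
    pd_symm hU (hu1 k) i j z hz
  have s3' : ∀ i j k, pd i (pd j (pd k u)) z = pd i (pd k (pd j u)) z := fun i j k =>
    pd_congr hU (pd_symm hU (hu.of_le (by norm_num)) j k) i z hz
  have e1 : ∀ k, pd k (X1 γ lam u f) z =
      (pd 2 (pd 3 u) z * pd k (pd 0 f) z + pd 0 f z * pd k (pd 2 (pd 3 u)) z)
      - (pd 0 (pd 2 u) z * pd k (pd 3 f) z + pd 3 f z * pd k (pd 0 (pd 2 u)) z)
      + γ * lam * ((pd 2 (pd 3 u) z * pd k (pd 0 f) z + pd 0 f z * pd k (pd 2 (pd 3 u)) z)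
        - (pd 0 (pd 3 u) z * pd k (pd 2 f) z + pd 2 f z * pd k (pd 0 (pd 3 u)) z)) := by
    intro k
    have a1 := (du 2 3).fun_mul (df 0)
    have a2 := (du 0 2).fun_mul (df 3)
    have a3 := (du 0 3).fun_mul (df 2)
    unfold X1
    rw [pd_add (a1.fun_sub a2) ((a1.fun_sub a3).const_mul _), pd_sub a1 a2,
      pd_cmul _ (a1.fun_sub a3), pd_sub a1 a3, pd_mul (du _ _) (df _), pd_mul (du _ _) (df _),
      pd_mul (du _ _) (df _)]
  have e2 : ∀ k, pd k (X2 β lam u f) z =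
      (pd 1 (pd 2 u) z * pd k (pd 3 f) z + pd 3 f z * pd k (pd 1 (pd 2 u)) z)
      - (pd 2 (pd 3 u) z * pd k (pd 1 f) z + pd 1 f z * pd k (pd 2 (pd 3 u)) z)
      + β * lam * ((pd 2 (pd 3 u) z * pd k (pd 1 f) z + pd 1 f z * pd k (pd 2 (pd 3 u)) z)
        - (pd 1 (pd 3 u) z * pd k (pd 2 f) z + pd 2 f z * pd k (pd 1 (pd 3 u)) z)) := by
    intro k
    have a1 := (du 1 2).fun_mul (df 3)
    have a2 := (du 2 3).fun_mul (df 1)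
    have a3 := (du 1 3).fun_mul (df 2)
    unfold X2
    rw [pd_add (a1.fun_sub a2) ((a2.fun_sub a3).const_mul _), pd_sub a1 a2,
      pd_cmul _ (a2.fun_sub a3), pd_sub a2 a3, pd_mul (du _ _) (df _), pd_mul (du _ _) (df _),
      pd_mul (du _ _) (df _)]
  have eP : ∀ k,
      α * (pd 0 (pd 1 u) z * pd k (pd 2 (pd 3 u)) z + pd 2 (pd 3 u) z * pd k (pd 0 (pd 1 u)) z)
      + β * (pd 0 (pd 2 u) z * pd k (pd 1 (pd 3 u)) z + pd 1 (pd 3 u) z * pd k (pd 0 (pd 2 u)) z)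
      + γ * (pd 0 (pd 3 u) z * pd k (pd 1 (pd 2 u)) z + pd 1 (pd 2 u) z * pd k (pd 0 (pd 3 u)) z)
      = 0 := by
    intro k
    have h0 : pd k (Phi α β γ u) z = 0 := by
      rw [pd_congr hU (h := fun _ => 0) heav k z hz]
      simp [pd]
    have a1 := (du 0 1).fun_mul (du 2 3)
    have a2 := (du 0 2).fun_mul (du 1 3)
    have a3 := (du 0 3).fun_mul (du 1 2)
    rw [← h0]
    unfold Phi
    simp only [mul_assoc]
    rw [pd_add ((a1.const_mul _).fun_add (a2.const_mul _)) (a3.const_mul _),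
      pd_add (a1.const_mul _) (a2.const_mul _), pd_cmul _ a1, pd_cmul _ a2, pd_cmul _ a3,
      pd_mul (du _ _) (du _ _), pd_mul (du _ _) (du _ _), pd_mul (du _ _) (du _ _)]
  have hP := heav z hz
  have hP3 := eP 2
  have hP4 := eP 3
  have x1 : ∀ g, X1 γ lam u g z = pd 2 (pd 3 u) z * pd 0 g z - pd 0 (pd 2 u) z * pd 3 g z
    + γ * lam * (pd 2 (pd 3 u) z * pd 0 g z - pd 0 (pd 3 u) z * pd 2 g z) := fun _ => rfl
  have x2 : ∀ g, X2 β lam u g z = pd 1 (pd 2 u) z * pd 3 g z - pd 2 (pd 3 u) z * pd 1 g z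
    + β * lam * (pd 2 (pd 3 u) z * pd 1 g z - pd 1 (pd 3 u) z * pd 2 g z) := fun _ => rfl
  have hα : α = -β - γ := by linear_combination hαβγ
  rw [x1 (X2 β lam u f), x2 (X1 γ lam u f), x1 f, x2 f]
  simp only [e1, e2]
  unfold Phi at hP
  subst hα
  simp only [s3, s3', sf] at hP hP3 hP4 ⊢
  linear_combination lam * (pd 2 f z * (pd 2 (pd 3 u) z * hP4 - pd 2 (pd 3 (pd 3 u)) z * hP)
    - pd 3 f z * (pd 2 (pd 3 u) z * hP3 - pd 2 (pd 2 (pd 3 u)) z * hP))
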